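/- Given a morphism σ : Δ ⟶ Γ, a morphism τ : Θ ⟶ Δ, and distinguished squares for A, for A∘σ, and for A∘σ∘τ, the canonical lifts compose strictly: q_{σ∘τ} = q_σ ∘ q_τ, where q_τ denotes the canonical lift of τ relative to the family A∘σ, q_σ the canonical lift of σ relative to A, and q_{σ∘τ} the canonical lift of σ∘τ relative to A. Moreover, the canonical lift of id_Γ relative to A, computed using the same distinguished square for A on both sides, equals id_{Γ.A}. (Hence a choice of distinguished squares yields a split, i.e. strictly functorial, reindexing of families.) -/

import Mathlib

open CategoryTheory

/-- Given a morphism `π : Ũ ⟶ U`, distinguished (pullback) squares for the family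
`A : Γ ⟶ U`, for `A ∘ σ`, and for `A ∘ σ ∘ τ`, the canonical lifts compose strictly
(`q_{σ∘τ} = q_σ ∘ q_τ`), and the canonical lift of the identity is the identity. -/
theorem canonical_lifts_compose_strictly {C : Type*} [Category C]
    {Utilde U Γ Δ Θ ΓA ΔA ΘA : C}
    (π : Utilde ⟶ U) (A : Γ ⟶ U) (σ : Δ ⟶ Γ) (τ : Θ ⟶ Δ)
    -- distinguished square for A
    (pA : ΓA ⟶ Γ) (qA : ΓA ⟶ Utilde) (hA : IsPullback qA pA π A)
    -- distinguished square for A ∘ σ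
    (pB : ΔA ⟶ Δ) (qB : ΔA ⟶ Utilde) (hB : IsPullback qB pB π (σ ≫ A))
    -- distinguished square for A ∘ σ ∘ τ
    (pC : ΘA ⟶ Θ) (qC : ΘA ⟶ Utilde) (hC : IsPullback qC pC π (τ ≫ σ ≫ A))
    -- the canonical lift of σ relative to A
    (qσ : ΔA ⟶ ΓA) (hqσp : qσ ≫ pA = pB ≫ σ) (hqσq : qσ ≫ qA = qB)
    -- the canonical lift of τ relative to A ∘ σ
    (qτ : ΘA ⟶ ΔA) (hqτp : qτ ≫ pB = pC ≫ τ) (hqτq : qτ ≫ qB = qC)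
    -- the canonical lift of σ ∘ τ relative to A
    (qστ : ΘA ⟶ ΓA) (hqστp : qστ ≫ pA = pC ≫ (τ ≫ σ)) (hqστq : qστ ≫ qA = qC) :
    qστ = qτ ≫ qσ ∧
      ∀ ℓ : ΓA ⟶ ΓA, ℓ ≫ pA = pA ≫ 𝟙 Γ → ℓ ≫ qA = qA → ℓ = 𝟙 ΓA := by
  refine ⟨hA.hom_ext ?_ ?_, fun ℓ hp hq => hA.hom_ext ?_ ?_⟩
  · rw [Category.assoc, hqσq, hqτq, hqστq]
  · rw [Category.assoc, hqσp, reassoc_of% hqτp, hqστp]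
  · rw [hq, Category.id_comp]
  · rw [hp, Category.comp_id, Category.id_comp]
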